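/- Let C be a unital C*-algebra and φ a state on C. If the projection filter P_φ is downwards cofinal in the quantum filter F_φ (for every a ∈ F_φ there is p ∈ P_φ with p ≤ a and p·a = p), then P_φ is countably closed: for every sequence (p_n) in P_φ there exists p ∈ P_φ with p ≤ p_n for all n. -/

import Mathlib

open scoped ComplexOrder

noncomputable section

variable {C : Type*} [CStarAlgebra C] [PartialOrder C] [StarOrderedRing C]

/-- A state on `C`. -/
def IsState (φ : C →L[ℂ] ℂ) : Prop :=
  φ 1 = 1 ∧ ∀ a : C, 0 ≤ a → 0 ≤ φ a

/-- The quantum filter `F_φ` of a state `φ`. -/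
def QuantumFilter (φ : C →L[ℂ] ℂ) : Set C := {a | 0 ≤ a ∧ ‖a‖ = 1 ∧ φ a = 1}

/-- The projection filter `P_φ` of a state `φ`. -/
def ProjFilter (φ : C →L[ℂ] ℂ) : Set C := {p | star p = p ∧ p * p = p ∧ φ p = 1}

section Auxiliary

variable {A : Type*} [CStarAlgebra A] [PartialOrder A] [StarOrderedRing A]

/-- If `q * a = q` and `1 - a` dominates a positive multiple of `1 - p`, then `q ≤ p`. -/
theorem IsStarProjection.le_of_mul_eq_of_smul_le {p q a : A} {c : ℝ} (hp : IsStarProjection p)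
    (hq : IsStarProjection q) (hc : 0 < c) (hqa : q * a = q) (h : c • (1 - p) ≤ 1 - a) :
    q ≤ p := by
  refine hq.le_of_mul_eq_right hp ?_
  have hle : c • (q * (1 - p) * q) ≤ 0 := by
    have := star_left_conjugate_le_conjugate h q
    simpa [hq.isSelfAdjoint.star_eq, mul_sub, hqa] using this
  have hnn : 0 ≤ q * (1 - p) * q := by
    simpa [hq.isSelfAdjoint.star_eq] using star_left_conjugate_nonneg hp.one_sub_nonneg q
  have hzero : q * (1 - p) * q = 0 :=
    (smul_eq_zero.mp (le_antisymm hle (smul_nonneg hc.le hnn))).resolve_left hc.ne'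
  have hstar : star ((1 - p) * q) * ((1 - p) * q) = 0 := by
    rw [star_mul, hq.isSelfAdjoint.star_eq, hp.one_sub.isSelfAdjoint.star_eq, mul_assoc,
      ← mul_assoc (1 - p), hp.one_sub.isIdempotentElem.eq, ← mul_assoc, hzero]
  have hpq := CStarRing.star_mul_self_eq_zero_iff _ |>.mp hstar
  rw [sub_mul, one_mul, sub_eq_zero] at hpq
  exact hpq.symm

/-- A positive element on which a state takes the value `1` has norm at least `1`. -/
theorem IsState.one_le_norm {φ : A →L[ℂ] ℂ} (hφ : IsState φ) {a : A} (ha : 0 ≤ a)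
    (h : φ a = 1) : 1 ≤ ‖a‖ := by
  have hle : a ≤ algebraMap ℝ A ‖a‖ := IsSelfAdjoint.le_algebraMap_norm_self (.of_nonneg ha)
  have hpos := hφ.2 _ (sub_nonneg.mpr hle)
  rw [map_sub, h, Algebra.algebraMap_eq_smul_one, φ.map_smul_of_tower, hφ.1, sub_nonneg] at hpos
  simpa using (Complex.le_def.mp hpos).1

end Auxiliary

/-- Let `C` be a unital C*-algebra and `φ` a state on `C`.  If `P_φ` is downwards
cofinal in `F_φ`, then `P_φ` is countably closed: every sequence in `P_φ` has a lower bound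
in `P_φ`. -/
theorem projFilter_countably_closed_of_cofinal
    (φ : C →L[ℂ] ℂ) (hstate : IsState φ)
    (hcof : ∀ a ∈ QuantumFilter φ, ∃ p ∈ ProjFilter φ, p ≤ a ∧ p * a = p) :
    ∀ p : ℕ → C, (∀ n, p n ∈ ProjFilter φ) →
      ∃ q ∈ ProjFilter φ, ∀ n, q ≤ p n := by
  intro p hp
  have hproj {e : C} (he : e ∈ ProjFilter φ) : IsStarProjection e := ⟨he.2.1, he.1⟩
  set c : ℕ → ℝ := fun n ↦ 1 / 2 / 2 ^ n
  have hc : HasSum c 1 := hasSum_geometric_two' 1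
  have hcpos (n : ℕ) : 0 < c n := by positivity
  have hnorm (n : ℕ) : ‖c n • p n‖ ≤ c n := by
    rw [norm_smul, Real.norm_of_nonneg (hcpos n).le]
    exact mul_le_of_le_one_right (hcpos n).le (hproj (hp n)).norm_le
  have hsum : Summable fun n ↦ c n • p n := .of_norm_bounded hc.summable hnorm
  obtain ⟨a, ha⟩ := hsum
  have ha0 : 0 ≤ a := ha.nonneg fun n ↦ smul_nonneg (hcpos n).le (hproj (hp n)).nonneg
  have hφa : φ a = 1 := by
    refine (ha.mapL φ).unique ?_
    have hφp (n : ℕ) : φ (c n • p n) = (c n : ℂ) := by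
      rw [φ.map_smul_of_tower, (hp n).2.2]
      simp
    simpa only [hφp, Complex.ofReal_one] using Complex.hasSum_ofReal.mpr hc
  have ha1 : ‖a‖ ≤ 1 := ha.norm_le_of_bounded hc hnorm
  obtain ⟨q, hq, -, hqa⟩ := hcof a ⟨ha0, ha1.antisymm (hstate.one_le_norm ha0 hφa), hφa⟩
  refine ⟨q, hq, fun n ↦
    (hproj (hp n)).le_of_mul_eq_of_smul_le (hproj hq) (hcpos n) hqa ?_⟩
  have hcompl : HasSum (fun n ↦ c n • (1 - p n)) (1 - a) := by
    simpa [smul_sub] using (hc.smul_const (1 : C)).sub ha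
  exact le_hasSum hcompl n fun m _ ↦ smul_nonneg (hcpos m).le (hproj (hp m)).one_sub_nonneg

end
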